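/- Let M be a finite-horizon MDP with initial state s0 and rewards in [0,1], and let (s,a) be α-important for M, i.e. the optimal value of the modified MDP M∖(s,a) (in which taking action a at s transitions to an absorbing terminal state with zero reward) satisfies V^{M∖(s,a),*}_0(s0) < V^{M,*}_0(s0) − α. Let π_1, …, π_N be policies whose average suboptimality satisfies (1/N) Σ_{k=1}^{N} (V^{M,*}_0(s0) − V^{M,π_k}_0(s0)) < α/2. Then the probability that a uniformly random one of these policies visits (s,a) satisfies (1/N) Σ_{k=1}^{N} P((s,a) ∈ τ_{π_k}) > α/(2H). -/

import Mathlib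

open Finset

namespace MDPform

variable {S A : Type}

/-- Probability that a deterministic nonstationary policy `π`, run from `s0` for `H` steps
in an MDP with (time-dependent) dynamics `P`, produces the state trajectory `τ`. -/
def trajProb [Fintype S] [DecidableEq S] (P : ℕ → S → A → S → ℝ) (π : ℕ → S → A)
    (s0 : S) (H : ℕ) (τ : Fin (H + 1) → S) : ℝ :=
  (if τ 0 = s0 then (1 : ℝ) else 0) *
    ∏ h : Fin H, P h (τ h.castSucc) (π h (τ h.castSucc)) (τ h.succ)

/-- Sum of rewards along a trajectory. -/
def ret (r : S → A → ℝ) (π : ℕ → S → A) (H : ℕ) (τ : Fin (H + 1) → S) : ℝ :=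
  ∑ h : Fin H, r (τ h.castSucc) (π h (τ h.castSucc))

/-- Value `V^{M,π}_0(s0)` of policy `π`. -/
def value [Fintype S] [DecidableEq S] (P : ℕ → S → A → S → ℝ) (r : S → A → ℝ)
    (π : ℕ → S → A) (s0 : S) (H : ℕ) : ℝ :=
  ∑ τ : Fin (H + 1) → S, trajProb P π s0 H τ * ret r π H τ

/-- Optimal value `V^{M,*}_0(s0)`. -/
noncomputable def optValue [Fintype S] [DecidableEq S] (P : ℕ → S → A → S → ℝ)
    (r : S → A → ℝ) (s0 : S) (H : ℕ) : ℝ :=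
  ⨆ π : ℕ → S → A, value P r π s0 H

/-- Probability of a set of trajectories. -/
noncomputable def probEvent [Fintype S] [DecidableEq S] (P : ℕ → S → A → S → ℝ)
    (π : ℕ → S → A) (s0 : S) (H : ℕ) (E : Set (Fin (H + 1) → S)) : ℝ :=
  ∑ τ : Fin (H + 1) → S, E.indicator (trajProb P π s0 H) τ

/-- Probability that the trajectory of `π` visits the state-action pair `(s,a)`. -/
noncomputable def visitProb [Fintype S] [DecidableEq S] (P : ℕ → S → A → S → ℝ)
    (π : ℕ → S → A) (s0 : S) (H : ℕ) (s : S) (a : A) : ℝ :=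
  probEvent P π s0 H {τ | ∃ h : Fin H, τ h.castSucc = s ∧ π h (τ h.castSucc) = a}

/-- A transition kernel is stochastic: nonnegative entries, rows summing to one. -/
def IsStochastic [Fintype S] (P : S → A → S → ℝ) : Prop :=
  (∀ s a s', 0 ≤ P s a s') ∧ ∀ s a, ∑ s' : S, P s a s' = 1

/-- The dynamics of `M∖(s,a)`: the terminal state `⊖` is modelled by `none`, is absorbing,
and taking action `a` at state `s` transitions deterministically to it. -/
def removeSA [DecidableEq S] [DecidableEq A] (P : S → A → S → ℝ) (s : S) (a : A) :
    Option S → A → Option S → ℝ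
  | none, _, y => if y = none then 1 else 0
  | some x, u, y =>
      if x = s ∧ u = a then (if y = none then 1 else 0)
      else Option.elim y 0 (fun y' => P x u y')

/-- Rewards lifted to `M∖(s,a)`: the terminal state carries zero reward. -/
def liftReward (r : S → A → ℝ) : Option S → A → ℝ
  | none, _ => 0
  | some x, u => r x u

/-- Backward-recursive value `V^{M,π}_h(s)` for time-dependent dynamics. -/
def Vpol [Fintype S] (P : ℕ → S → A → S → ℝ) (r : S → A → ℝ) (π : ℕ → S → A)
    (H : ℕ) (h : ℕ) (s : S) : ℝ :=
  if hlt : h < H then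
    r s (π h s) + ∑ s' : S, P h s (π h s) s' * Vpol P r π H (h + 1) s'
  else 0
termination_by H - h

lemma ret_nonneg {r : S → A → ℝ} (hr : ∀ x u, r x u ∈ Set.Icc (0 : ℝ) 1) (π : ℕ → S → A)
    (H : ℕ) (τ : Fin (H + 1) → S) : 0 ≤ ret r π H τ :=
  sum_nonneg fun _ _ => (hr _ _).1

lemma ret_le {r : S → A → ℝ} (hr : ∀ x u, r x u ∈ Set.Icc (0 : ℝ) 1) (π : ℕ → S → A)
    (H : ℕ) (τ : Fin (H + 1) → S) : ret r π H τ ≤ H :=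
  (sum_le_sum fun _ _ => (hr _ _).2).trans (by simp)

section Bounds

variable [Fintype S] [DecidableEq S] {P : ℕ → S → A → S → ℝ} {r : S → A → ℝ}

lemma trajProb_nonneg (hP : ∀ h x u y, P h x u y ∈ Set.Icc (0 : ℝ) 1) (π : ℕ → S → A)
    (s0 : S) (H : ℕ) (τ : Fin (H + 1) → S) : 0 ≤ trajProb P π s0 H τ :=
  mul_nonneg (by split_ifs <;> norm_num) (prod_nonneg fun _ _ => (hP _ _ _ _).1)

lemma trajProb_le_one (hP : ∀ h x u y, P h x u y ∈ Set.Icc (0 : ℝ) 1) (π : ℕ → S → A)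
    (s0 : S) (H : ℕ) (τ : Fin (H + 1) → S) : trajProb P π s0 H τ ≤ 1 :=
  mul_le_one₀ (by split_ifs <;> norm_num) (prod_nonneg fun _ _ => (hP _ _ _ _).1)
    (prod_le_one (fun _ _ => (hP _ _ _ _).1) fun _ _ => (hP _ _ _ _).2)

lemma bddAbove_range_value (hP : ∀ h x u y, P h x u y ∈ Set.Icc (0 : ℝ) 1)
    (hr : ∀ x u, r x u ∈ Set.Icc (0 : ℝ) 1) (s0 : S) (H : ℕ) :
    BddAbove (Set.range fun π : ℕ → S → A => value P r π s0 H) := by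
  refine ⟨∑ _τ : Fin (H + 1) → S, 1 * (H : ℝ), ?_⟩
  rintro _ ⟨π, rfl⟩
  exact sum_le_sum fun τ _ => mul_le_mul (trajProb_le_one hP π s0 H τ) (ret_le hr π H τ)
    (ret_nonneg hr π H τ) zero_le_one

lemma value_le_optValue (hP : ∀ h x u y, P h x u y ∈ Set.Icc (0 : ℝ) 1)
    (hr : ∀ x u, r x u ∈ Set.Icc (0 : ℝ) 1) (π : ℕ → S → A) (s0 : S) (H : ℕ) :
    value P r π s0 H ≤ optValue P r s0 H :=
  le_ciSup (bddAbove_range_value hP hr s0 H) π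

end Bounds

lemma IsStochastic.mem_Icc [Fintype S] {P : S → A → S → ℝ} (hP : IsStochastic P)
    (x : S) (u : A) (y : S) : P x u y ∈ Set.Icc (0 : ℝ) 1 :=
  ⟨hP.1 x u y, hP.2 x u ▸ single_le_sum (fun z _ => hP.1 x u z) (mem_univ y)⟩

lemma removeSA_mem_Icc [DecidableEq S] [DecidableEq A] {P : S → A → S → ℝ}
    (hP : ∀ x u y, P x u y ∈ Set.Icc (0 : ℝ) 1) (s : S) (a : A) (x : Option S) (u : A)
    (y : Option S) : removeSA P s a x u y ∈ Set.Icc (0 : ℝ) 1 := by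
  rcases x with _ | x <;> rcases y with _ | y <;> simp only [removeSA] <;> split_ifs <;>
    simp_all

lemma liftReward_mem_Icc {r : S → A → ℝ} (hr : ∀ x u, r x u ∈ Set.Icc (0 : ℝ) 1)
    (x : Option S) (u : A) : liftReward r x u ∈ Set.Icc (0 : ℝ) 1 := by
  rcases x with _ | x
  · simp [liftReward]
  · exact hr x u

/-- Extension of a policy to the state space of `M∖(s,a)`. -/
noncomputable def liftPolicy [Nonempty A] (π : ℕ → S → A) : ℕ → Option S → A :=
  fun h x => x.elim (Classical.arbitrary A) (π h)

lemma ret_liftPolicy [Nonempty A] (r : S → A → ℝ) (π : ℕ → S → A) (H : ℕ)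
    (τ : Fin (H + 1) → S) :
    ret (liftReward r) (liftPolicy π) H (some ∘ τ) = ret r π H τ :=
  rfl

lemma trajProb_removeSA_liftPolicy [Fintype S] [DecidableEq S] [DecidableEq A] [Nonempty A]
    (P : S → A → S → ℝ) (π : ℕ → S → A) (s0 s : S) (a : A) (H : ℕ) (τ : Fin (H + 1) → S)
    (hτ : ¬∃ h : Fin H, τ h.castSucc = s ∧ π h (τ h.castSucc) = a) :
    trajProb (fun _ => removeSA P s a) (liftPolicy π) (some s0) H (some ∘ τ) =
      trajProb (fun _ => P) π s0 H τ := by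
  unfold trajProb
  congr 1
  · simp
  · refine prod_congr rfl fun h _ => ?_
    exact if_neg fun hh => hτ ⟨h, hh⟩

lemma value_sub_le_value_removeSA [Fintype S] [DecidableEq S] [DecidableEq A] [Nonempty A]
    {P : S → A → S → ℝ} (hP : ∀ x u y, P x u y ∈ Set.Icc (0 : ℝ) 1) {r : S → A → ℝ}
    (hr : ∀ x u, r x u ∈ Set.Icc (0 : ℝ) 1) (π : ℕ → S → A) (s0 s : S) (a : A) (H : ℕ) :
    value (fun _ => P) r π s0 H - H * visitProb (fun _ => P) π s0 H s a ≤
      value (fun _ => removeSA P s a) (liftReward r) (liftPolicy π) (some s0) H := by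
  have hnonneg (τ : Fin (H + 1) → Option S) :
      0 ≤ trajProb (fun _ => removeSA P s a) (liftPolicy π) (some s0) H τ *
        ret (liftReward r) (liftPolicy π) H τ :=
    mul_nonneg (trajProb_nonneg (fun _ => removeSA_mem_Icc hP s a) _ _ _ _)
      (ret_nonneg (liftReward_mem_Icc hr) _ _ _)
  let e : (Fin (H + 1) → S) ↪ (Fin (H + 1) → Option S) :=
    ⟨fun τ => some ∘ τ, (Option.some_injective S).comp_left⟩
  calc
    _ ≤ ∑ τ : Fin (H + 1) → S,
        trajProb (fun _ => removeSA P s a) (liftPolicy π) (some s0) H (e τ) *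
          ret (liftReward r) (liftPolicy π) H (e τ) := by
      unfold value visitProb probEvent
      rw [mul_sum, ← sum_sub_distrib]
      refine sum_le_sum fun τ _ => ?_
      by_cases hτ : ∃ h : Fin H, τ h.castSucc = s ∧ π h (τ h.castSucc) = a
      · refine le_trans ?_ (hnonneg _)
        rw [Set.indicator_of_mem (by exact hτ), mul_comm (H : ℝ), ← mul_sub]
        exact mul_nonpos_of_nonneg_of_nonpos (trajProb_nonneg (fun _ => hP) _ _ _ _)
          (sub_nonpos.2 (ret_le hr _ _ _))
      · rw [Set.indicator_of_notMem (by exact hτ), mul_zero, sub_zero]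
        exact (congrArg₂ (· * ·) (trajProb_removeSA_liftPolicy P π s0 s a H τ hτ)
          (ret_liftPolicy r π H τ)).ge
    _ ≤ _ := by
      rw [← sum_map univ e fun τ =>
        trajProb (fun _ => removeSA P s a) (liftPolicy π) (some s0) H τ *
          ret (liftReward r) (liftPolicy π) H τ]
      exact sum_le_univ_sum_of_nonneg hnonneg

/-- If `(s,a)` is `α`-important for `M` and the policies `π_1, …, π_N`
have average suboptimality less than `α/2`, then a uniformly random one of them visits
`(s,a)` with probability greater than `α/(2H)`. -/
theorem average_importance_implies_visitation
    {S A : Type} [Fintype S] [DecidableEq S] [Nonempty S]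
    [Fintype A] [DecidableEq A] [Nonempty A]
    (P : S → A → S → ℝ) (hP : IsStochastic P)
    (r : S → A → ℝ) (hr : ∀ s a, r s a ∈ Set.Icc (0 : ℝ) 1)
    (H : ℕ) (s0 s : S) (a : A) (α : ℝ)
    (himp : optValue (fun _ => removeSA P s a) (liftReward r) (some s0) H <
      optValue (fun _ => P) r s0 H - α)
    (N : ℕ) (hN : 0 < N) (π : Fin N → ℕ → S → A)
    (havg : (1 / (N : ℝ)) *
        ∑ k : Fin N, (optValue (fun _ => P) r s0 H - value (fun _ => P) r (π k) s0 H) <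
      α / 2) :
    (1 / (N : ℝ)) * ∑ k : Fin N, visitProb (fun _ => P) (π k) s0 H s a > α / (2 * H) := by
  have hP' := hP.mem_Icc
  have hN' : (0 : ℝ) < N := by exact_mod_cast hN
  have hα : 0 < α / 2 := lt_of_le_of_lt (mul_nonneg (by positivity)
    (sum_nonneg fun k _ => sub_nonneg.2 (value_le_optValue (fun _ => hP') hr _ _ _))) havg
  have hpos : 0 < H := by
    rcases Nat.eq_zero_or_pos H with rfl | h
    · simp only [optValue, value, ret, univ_eq_empty, sum_empty, mul_zero, sum_const_zero,
        ciSup_const] at himp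
      linarith
    · exact h
  have hH : (0 : ℝ) < H := by exact_mod_cast hpos
  have hk (k : Fin N) : α ≤ (optValue (fun _ => P) r s0 H - value (fun _ => P) r (π k) s0 H) +
      H * visitProb (fun _ => P) (π k) s0 H s a := by
    have h₁ := value_sub_le_value_removeSA hP' hr (π k) s0 s a H
    have h₂ := value_le_optValue (fun _ => removeSA_mem_Icc hP' s a) (liftReward_mem_Icc hr)
      (liftPolicy (π k)) (some s0) H
    linarith
  have hsum := sum_le_sum fun k (_ : k ∈ univ) => hk k
  rw [sum_add_distrib, ← mul_sum, sum_const, card_univ, Fintype.card_fin, nsmul_eq_mul] at hsum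
  rw [one_div, inv_mul_lt_iff₀ hN'] at havg
  rw [gt_iff_lt, one_div, lt_inv_mul_iff₀ hN', mul_div_assoc', div_lt_iff₀ (by positivity)]
  linarith

end MDPform
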